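/- Let A = (A_1,…,A_q) be a system of endomorphisms of V. For every even integer r ≥ 0, the scalar S_r(A) is the following linear combination of the coefficients σ_u(A): S_r(A) = Σ_{u ∈ 2ℕ(q), |u| = r} C(r/2, u/2) · C(r,u)^{-1} · σ_u(A), where C(r/2, u/2) = (r/2)! / ((u_1/2)!⋯(u_q/2)!) and C(r,u) = r!/(u_1!⋯u_q!). -/

import Mathlib

open scoped BigOperators

namespace GNTPaper

variable {p q : ℕ}

/-- The Newton polynomial `P_A(t) = det(1_V + tA)` of a system of endomorphisms
(represented as matrices w.r.t. an orthonormal basis), as a multivariate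
polynomial in the variables `t_1, …, t_q`. -/
noncomputable def newtonMvPoly (A : Fin q → Matrix (Fin p) (Fin p) ℝ) :
    MvPolynomial (Fin q) ℝ :=
  Matrix.det (1 + ∑ α : Fin q, (MvPolynomial.X α : MvPolynomial (Fin q) ℝ) •
    (A α).map (fun x => (MvPolynomial.C x : MvPolynomial (Fin q) ℝ)))

/-- `σ_u(A)`: the coefficient of `t^u` in the Newton polynomial `P_A(t) = det(1 + tA)`. -/
noncomputable def sigma (A : Fin q → Matrix (Fin p) (Fin p) ℝ) (u : Fin q → ℕ) : ℝ :=
  MvPolynomial.coeff (Finsupp.equivFunOnFinite.symm u) (newtonMvPoly A)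

/-- A matrix `i ∈ I(q,s)` (a `q × s` matrix of zeros and ones with exactly one `1`
in each column) is encoded by the function `c : Fin s → Fin q` recording, for each
column `l`, the row `c l` containing its unique entry `1`.  `wt c α` is then the
weight `|i^α| = Σ_l i^α_l`, i.e. the number of columns whose `1` lies in row `α`. -/
def wt {s : ℕ} (c : Fin s → Fin q) (α : Fin q) : ℕ :=
  (Finset.univ.filter fun l => c l = α).card

/-- The ordered composition `A^i = A_{c(1)} ⬝ A_{c(2)} ⬝ ⋯ ⬝ A_{c(s)}` associated to a
matrix `i ∈ I(q,s)` encoded by `c : Fin s → Fin q` (`A^i = 1` for `s = 0`). -/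
noncomputable def prodSeq (A : Fin q → Matrix (Fin p) (Fin p) ℝ) {s : ℕ}
    (c : Fin s → Fin q) : Matrix (Fin p) (Fin p) ℝ :=
  (List.ofFn fun l => A (c l)).prod

/-- `σ_{u - |i|}(A)`, where by convention it is `0` whenever `u - |i|` has a
negative entry. -/
noncomputable def sigmaSub (A : Fin q → Matrix (Fin p) (Fin p) ℝ) (u : Fin q → ℕ)
    {s : ℕ} (c : Fin s → Fin q) : ℝ :=
  if ∀ α, wt c α ≤ u α then sigma A (fun α => u α - wt c α) else 0

/-- The generalized Newton transformation
`T_u(A) = Σ_{s=0}^{|u|} Σ_{i ∈ I(q,s)} (-1)^{‖i‖} σ_{u-|i|}(A) A^i`. -/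
noncomputable def gnt (A : Fin q → Matrix (Fin p) (Fin p) ℝ) (u : Fin q → ℕ) :
    Matrix (Fin p) (Fin p) ℝ :=
  ∑ s ∈ Finset.range ((∑ α, u α) + 1),
    (-1 : ℝ) ^ s • ∑ c : Fin s → Fin q, sigmaSub A u c • prodSeq A c

/-- `T_{α♭(u)}(A)`, with the convention that it is `0` when `u α = 0`. -/
noncomputable def gntFlat (A : Fin q → Matrix (Fin p) (Fin p) ℝ) (α : Fin q)
    (u : Fin q → ℕ) : Matrix (Fin p) (Fin p) ℝ :=
  if u α = 0 then 0 else gnt A (Function.update u α (u α - 1))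

/-- `σ_{α♭(u)}(A)`, with the convention that it is `0` when `u α = 0`. -/
noncomputable def sigmaFlat (A : Fin q → Matrix (Fin p) (Fin p) ℝ) (α : Fin q)
    (u : Fin q → ℕ) : ℝ :=
  if u α = 0 then 0 else sigma A (Function.update u α (u α - 1))

/-- The generalized Kronecker symbol `δ^{i_1…i_r}_{j_1…j_r}`, equal to `+1` (resp. `-1`)
if the `i`'s are distinct and the `j`'s are an even (resp. odd) permutation of the `i`'s,
and `0` otherwise; given by the classical determinant formula `det(δ_{i_k j_l})_{k,l}`. -/
noncomputable def gkron {n r : ℕ} (i j : Fin r → Fin n) : ℝ :=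
  Matrix.det (Matrix.of fun k l : Fin r => if i k = j l then (1 : ℝ) else 0)

/-- For `k < 2m`, the index `⌊k/2⌋ < m`; used to pair consecutive indices. -/
def halfIdx {m : ℕ} (k : Fin (2 * m)) : Fin m :=
  ⟨(k : ℕ) / 2, Nat.div_lt_of_lt_mul k.isLt⟩

/-- The scalar `S_r(A)` (for `r = 2m` even) from Reilly's construction. -/
noncomputable def Sr (A : Fin q → Matrix (Fin p) (Fin p) ℝ) (m : ℕ) : ℝ :=
  (1 / ((2 * m).factorial : ℝ)) *
    ∑ iv : Fin (2 * m) → Fin p, ∑ jv : Fin (2 * m) → Fin p,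
      gkron iv jv * ∑ a : Fin m → Fin q, ∏ k : Fin (2 * m), A (a (halfIdx k)) (iv k) (jv k)

/-- The Reilly operator `T_r(A)` (for `r = 2m` even). -/
noncomputable def TrReilly (A : Fin q → Matrix (Fin p) (Fin p) ℝ) (m : ℕ) :
    Matrix (Fin p) (Fin p) ℝ :=
  Matrix.of fun i j => (1 / ((2 * m).factorial : ℝ)) *
    ∑ iv : Fin (2 * m) → Fin p, ∑ jv : Fin (2 * m) → Fin p,
      gkron (Fin.snoc iv i) (Fin.snoc jv j) *
        ∑ a : Fin m → Fin q, ∏ k : Fin (2 * m), A (a (halfIdx k)) (iv k) (jv k)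

/-- The Reilly operator `T_{r+1}^α(A)` (for `r = 2m` even). -/
noncomputable def Tr1Reilly (A : Fin q → Matrix (Fin p) (Fin p) ℝ) (m : ℕ) (α : Fin q) :
    Matrix (Fin p) (Fin p) ℝ :=
  Matrix.of fun i j => (1 / ((2 * m).factorial : ℝ)) *
    ∑ iv : Fin (2 * m + 1) → Fin p, ∑ jv : Fin (2 * m + 1) → Fin p,
      gkron (Fin.snoc iv i) (Fin.snoc jv j) *
        (A α (iv (Fin.last (2 * m))) (jv (Fin.last (2 * m))) *
          ∑ a : Fin m → Fin q, ∏ k : Fin (2 * m),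
            A (a (halfIdx k)) (iv k.castSucc) (jv k.castSucc))

/-- The (finite) set of multi-indices `u ∈ 2ℕ(q)` with `|u| = r` (all entries even,
total length `r`). -/
noncomputable def evenIdx (q r : ℕ) : Finset (Fin q → ℕ) :=
  (Fintype.piFinset fun _ : Fin q => Finset.range (r + 1)).filter
    fun u => (∀ α, Even (u α)) ∧ ∑ α, u α = r

open Finset MvPolynomial

/-- Contracting the lower indices of the generalized Kronecker symbol gives a determinant. -/
lemma sum_gkron_mul_prod {n r : ℕ} (i : Fin r → Fin n) (N : Fin r → Fin n → ℝ) :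
    ∑ j : Fin r → Fin n, gkron i j * ∏ k, N k (j k) =
      Matrix.det (Matrix.of fun k l => N k (i l)) := by
  have hprod (π : Equiv.Perm (Fin r)) :
      ∑ j : Fin r → Fin n, (∏ k, if i (π k) = j k then (1 : ℝ) else 0) * ∏ k, N k (j k) =
        ∏ k, N k (i (π k)) := by
    simp_rw [← Finset.prod_mul_distrib]
    rw [← Fintype.piFinset_univ,
      ← Finset.prod_univ_sum (fun _ => univ) fun k x =>
        (if i (π k) = x then (1 : ℝ) else 0) * N k x]
    simp
  rw [← Matrix.det_transpose]
  simp_rw [gkron, Matrix.det_apply', Finset.sum_mul]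
  rw [Finset.sum_comm]
  refine Finset.sum_congr rfl fun π _ => ?_
  simp_rw [mul_assoc, ← Finset.mul_sum]
  congr 1
  exact hprod _

/-- The polarized sum of principal `r × r` minors: the `k`-th row is taken from `A (c k)`. -/
noncomputable def mixedMinorSum (A : Fin q → Matrix (Fin p) (Fin p) ℝ) {r : ℕ}
    (c : Fin r → Fin q) : ℝ :=
  ∑ i : Fin r → Fin p, Matrix.det (Matrix.of fun k l => A (c k) (i k) (i l))

lemma mixedMinorSum_comp_perm (A : Fin q → Matrix (Fin p) (Fin p) ℝ) {r : ℕ}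
    (c : Fin r → Fin q) (π : Equiv.Perm (Fin r)) :
    mixedMinorSum A (c ∘ π) = mixedMinorSum A c := by
  unfold mixedMinorSum
  rw [← Equiv.sum_comp (Equiv.arrowCongr π.symm (Equiv.refl (Fin p)))]
  refine Finset.sum_congr rfl fun i _ => ?_
  exact Matrix.det_submatrix_equiv_self π (Matrix.of fun k l => A (c k) (i k) (i l))

lemma exists_perm_of_wt_eq {r : ℕ} {c d : Fin r → Fin q} (h : wt c = wt d) :
    ∃ π : Equiv.Perm (Fin r), c = d ∘ π := by
  have e (α : Fin q) : Nonempty ({k // c k = α} ≃ {k // d k = α}) := by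
    rw [← Fintype.card_eq, Fintype.card_subtype, Fintype.card_subtype]
    exact congrFun h α
  exact ⟨Equiv.ofFiberEquiv fun α => (e α).some, funext fun k =>
    (Equiv.ofFiberEquiv_map (fun α => (e α).some) k).symm⟩

lemma prod_X_comp {r : ℕ} (c : Fin r → Fin q) :
    ∏ k, (X (c k) : MvPolynomial (Fin q) ℝ) =
      monomial (Finsupp.equivFunOnFinite.symm (wt c)) 1 := by
  rw [monomial_eq, Finsupp.prod_fintype _ _ (by simp),
    ← Finset.prod_fiberwise' univ c (fun α => (X α : MvPolynomial (Fin q) ℝ))]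
  simp [wt]

lemma sum_wt {r : ℕ} (c : Fin r → Fin q) : ∑ α, wt c α = r := by
  simpa [wt] using (Finset.card_eq_sum_card_fiberwise (f := c) (s := univ) (t := univ)
    (by simp)).symm

lemma card_wt_eq_mul_prod_factorial {n : ℕ} {u : Fin q → ℕ} (hu : ∑ α, u α = n) :
    #{c : Fin n → Fin q | wt c = u} * ∏ α, (u α).factorial = n.factorial := by
  have key : (#{c : Fin n → Fin q | wt c = u} : ℝ) = Nat.multinomial univ u := by
    have h : ∑ c : Fin n → Fin q, ∏ k, (X (c k) : MvPolynomial (Fin q) ℝ) =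
        ∑ v ∈ piAntidiag univ n,
          monomial (Finsupp.equivFunOnFinite.symm v) (Nat.multinomial univ v : ℝ) := by
      rw [← Fintype.piFinset_univ, ← Finset.prod_univ_sum (fun _ => univ) fun _ α => X α]
      simp only [prod_const, card_univ, Fintype.card_fin, sum_pow_eq_sum_piAntidiag]
      refine Finset.sum_congr rfl fun v _ => ?_
      rw [monomial_eq, Finsupp.prod_fintype _ _ (by simp)]
      simp
    replace h := congrArg (coeff (Finsupp.equivFunOnFinite.symm u)) h
    simp_rw [prod_X_comp, coeff_sum, coeff_monomial, EmbeddingLike.apply_eq_iff_eq] at h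
    simpa [hu] using h
  rw [Nat.cast_inj.mp key, mul_comm, Nat.multinomial_spec, hu]

/-- The generic linear combination `Σ_α X_α A_α`. -/
noncomputable def genericComb (A : Fin q → Matrix (Fin p) (Fin p) ℝ) :
    Matrix (Fin p) (Fin p) (MvPolynomial (Fin q) ℝ) :=
  ∑ α : Fin q, (X α : MvPolynomial (Fin q) ℝ) • (A α).map (fun x => C x)

lemma genericComb_apply (A : Fin q → Matrix (Fin p) (Fin p) ℝ) (i j : Fin p) :
    genericComb A i j = ∑ α, X α * C (A α i j) := by
  simp [genericComb, Matrix.sum_apply]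

lemma sum_mixedMinorSum_mul_prod_X (A : Fin q → Matrix (Fin p) (Fin p) ℝ) (r : ℕ) :
    ∑ c : Fin r → Fin q, C (mixedMinorSum A c) * ∏ k, X (c k) =
      ∑ i : Fin r → Fin p, ((genericComb A).submatrix i i).det := by
  simp_rw [mixedMinorSum, map_sum, Finset.sum_mul]
  rw [Finset.sum_comm]
  refine Finset.sum_congr rfl fun i _ => ?_
  have hrow : (genericComb A).submatrix i i = fun k =>
      ∑ α, (X α : MvPolynomial (Fin q) ℝ) • fun l => C (A α (i k) (i l)) := by
    funext k l
    simp [genericComb_apply, Finset.sum_apply]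
  have := (Matrix.detRowAlternating (n := Fin r)
    (R := MvPolynomial (Fin q) ℝ)).toMultilinearMap.map_sum
    (fun k α => (X α : MvPolynomial (Fin q) ℝ) • fun l => C (A α (i k) (i l)))
  rw [hrow]
  refine Eq.trans ?_ this.symm
  refine Finset.sum_congr rfl fun c _ => ?_
  rw [MultilinearMap.map_smul_univ, smul_eq_mul, mul_comm, RingHom.map_det]
  rfl

/-- `det (1 + M)` is the sum of all principal minors of `M`. -/
lemma det_one_add_eq_sum_minors {n R : Type*} [Fintype n] [DecidableEq n] [CommRing R]
    (M : Matrix n n R) :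
    (1 + M).det = ∑ s : Finset n, (M.submatrix ((↑) : s → n) (↑)).det := by
  rw [add_comm]
  change Matrix.detRowAlternating (M.row + (1 : Matrix n n R).row) = _
  rw [AlternatingMap.map_add_univ]
  exact Finset.sum_congr rfl fun s _ => Matrix.det_piecewise_one_eq_submatrix_det M s

/-- Summing minors over index sequences counts each principal minor `r!` times. -/
lemma sum_det_submatrix_eq {n R : Type*} [Fintype n] [DecidableEq n] [CommRing R]
    (M : Matrix n n R) (r : ℕ) :
    ∑ i : Fin r → n, (M.submatrix i i).det =
      r.factorial * ∑ s : Finset n with #s = r, (M.submatrix ((↑) : s → n) (↑)).det := by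
  classical
  have hinj : ∑ i : Fin r → n, (M.submatrix i i).det =
      ∑ i : Fin r → n with Function.Injective i, (M.submatrix i i).det := by
    refine (Finset.sum_filter_of_ne fun i _ hi => ?_).symm
    contrapose! hi
    obtain ⟨a, b, hab, hne⟩ := Function.not_injective_iff.mp hi
    exact Matrix.det_zero_of_row_eq hne (by ext l; simp [hab])
  rw [hinj, ← Finset.sum_fiberwise_of_maps_to (t := {s : Finset n | #s = r})
    (g := fun i => univ.image i), Finset.mul_sum]
  · refine Finset.sum_congr rfl fun s hs => ?_
    have hs : #s = r := by simpa using hs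
    have hsum : ∑ e : Fin r ≃ s, (M.submatrix (fun k => (e k : n)) (fun k => (e k : n))).det =
        ∑ i : Fin r → n with Function.Injective i ∧ univ.image i = s, (M.submatrix i i).det := by
      refine Finset.sum_bij (fun e _ k => (e k : n)) ?_ ?_ ?_ fun _ _ => rfl
      · intro e _
        simp only [mem_filter, mem_univ, true_and]
        refine ⟨Subtype.val_injective.comp e.injective, ?_⟩
        ext x
        simp only [mem_image, mem_univ, true_and]
        exact ⟨fun ⟨k, hk⟩ => hk ▸ (e k).2, fun hx => ⟨e.symm ⟨x, hx⟩, by simp⟩⟩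
      · intro e _ e' _ h
        ext k
        exact congrFun h k
      · intro i hi
        simp only [mem_filter, mem_univ, true_and] at hi
        obtain ⟨hi, rfl⟩ := hi
        refine ⟨Equiv.ofBijective (fun k => ⟨i k, by simp⟩)
          ⟨fun a b h => hi (congrArg Subtype.val h), ?_⟩, mem_univ _, rfl⟩
        rintro ⟨x, hx⟩
        obtain ⟨k, -, rfl⟩ := mem_image.mp hx
        exact ⟨k, rfl⟩
    rw [Finset.filter_filter, ← hsum]
    have hdet (e : Fin r ≃ s) : (M.submatrix (fun k => (e k : n)) (fun k => (e k : n))).det =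
        (M.submatrix ((↑) : s → n) (↑)).det :=
      Matrix.det_submatrix_equiv_self e (M.submatrix ((↑) : s → n) (↑))
    simp_rw [hdet]
    have hcard : Fintype.card (Fin r ≃ s) = r.factorial := by
      rw [Fintype.card_equiv (Fintype.equivOfCardEq (by simp [hs])), Fintype.card_fin]
    simp [hcard]
  · intro i hi
    simp only [mem_filter, mem_univ, true_and] at hi ⊢
    rw [Finset.card_image_of_injective _ hi, card_univ, Fintype.card_fin]

lemma isHomogeneous_det_genericComb_submatrix (A : Fin q → Matrix (Fin p) (Fin p) ℝ)
    (s : Finset (Fin p)) :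
    ((genericComb A).submatrix ((↑) : s → Fin p) (↑)).det.IsHomogeneous #s := by
  rw [Matrix.det_apply']
  refine IsHomogeneous.sum _ _ _ fun π _ => ?_
  have hentry (i j : Fin p) : (genericComb A i j).IsHomogeneous 1 := by
    rw [genericComb_apply]
    refine IsHomogeneous.sum _ _ _ fun α _ => ?_
    exact (isHomogeneous_X ℝ α).mul (isHomogeneous_C _ _)
  have hprod : (∏ k, (genericComb A).submatrix ((↑) : s → Fin p) (↑) (π k) k).IsHomogeneous #s := by
    simpa using IsHomogeneous.prod univ
      (fun k : s => (genericComb A).submatrix ((↑) : s → Fin p) (↑) (π k) k) (fun _ => 1)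
      fun k _ => hentry _ _
  simpa using hprod.C_mul (((Equiv.Perm.sign π : ℤˣ) : ℤ) : ℝ)

lemma factorial_mul_sigma (A : Fin q → Matrix (Fin p) (Fin p) ℝ) {r : ℕ} {u : Fin q → ℕ}
    (hu : ∑ α, u α = r) :
    (r.factorial : ℝ) * sigma A u = ∑ c : Fin r → Fin q with wt c = u, mixedMinorSum A c := by
  have hdeg : (Finsupp.equivFunOnFinite.symm u).degree = r := by
    rw [Finsupp.degree_eq_sum]
    exact hu
  have hsigma : sigma A u = coeff (Finsupp.equivFunOnFinite.symm u)
      (∑ s : Finset (Fin p) with #s = r,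
        ((genericComb A).submatrix ((↑) : s → Fin p) (↑)).det) := by
    change coeff _ (1 + genericComb A).det = _
    rw [det_one_add_eq_sum_minors, coeff_sum, coeff_sum]
    refine (Finset.sum_filter_of_ne fun s _ hs => ?_).symm
    contrapose! hs
    exact (isHomogeneous_det_genericComb_submatrix A s).coeff_eq_zero (by rw [hdeg]; exact hs.symm)
  have h := congrArg (coeff (Finsupp.equivFunOnFinite.symm u))
    ((sum_mixedMinorSum_mul_prod_X A r).trans (sum_det_submatrix_eq _ r))
  rw [← map_natCast (C : ℝ →+* MvPolynomial (Fin q) ℝ), coeff_C_mul, ← hsigma] at h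
  rw [← h, Finset.sum_filter]
  simp [prod_X_comp, coeff_sum, coeff_C_mul, coeff_monomial]

lemma mixedMinorSum_eq (A : Fin q → Matrix (Fin p) (Fin p) ℝ) {r : ℕ} (c : Fin r → Fin q) :
    mixedMinorSum A c = (∏ α, ((wt c α).factorial : ℝ)) * sigma A (wt c) := by
  have h := factorial_mul_sigma A (sum_wt c)
  have hconst : ∀ d ∈ ({d | wt d = wt c} : Finset (Fin r → Fin q)),
      mixedMinorSum A d = mixedMinorSum A c := by
    intro d hd
    obtain ⟨π, rfl⟩ := exists_perm_of_wt_eq (mem_filter.mp hd).2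
    exact mixedMinorSum_comp_perm A c π
  rw [Finset.sum_congr rfl hconst, Finset.sum_const, nsmul_eq_mul,
    ← card_wt_eq_mul_prod_factorial (sum_wt c)] at h
  have hne : (#{d : Fin r → Fin q | wt d = wt c} : ℝ) ≠ 0 :=
    Nat.cast_ne_zero.mpr (Finset.card_ne_zero_of_mem (a := c) (by simp))
  push_cast at h
  exact mul_left_cancel₀ hne (by rw [← h, mul_assoc])

lemma wt_comp_halfIdx {m : ℕ} (a : Fin m → Fin q) (α : Fin q) :
    wt (fun k => a (halfIdx k)) α = 2 * wt a α := by
  have hfib (l : Fin m) : #{k : Fin (2 * m) | halfIdx k = l} = 2 := by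
    have : ({k : Fin (2 * m) | halfIdx k = l} : Finset (Fin (2 * m))) =
        {⟨2 * l, by lia⟩, ⟨2 * l + 1, by lia⟩} := by
      ext k
      simp only [mem_filter, mem_univ, true_and, mem_insert, mem_singleton, halfIdx, Fin.ext_iff]
      lia
    rw [this, Finset.card_pair (by simp)]
  unfold wt
  rw [Finset.card_eq_sum_card_fiberwise (f := halfIdx) (t := {l | a l = α})
    (by intro k hk; simpa using hk)]
  rw [Finset.sum_congr rfl (g := fun _ => 2), Finset.sum_const, smul_eq_mul, mul_comm]
  intro l hl
  refine Eq.trans (congrArg Finset.card ?_) (hfib l)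
  rw [Finset.filter_filter]
  ext k
  simp only [mem_filter, mem_univ, true_and] at hl ⊢
  exact ⟨fun h => h.2, fun h => ⟨by rw [h, hl], h⟩⟩

lemma Sr_eq_sum_mixedMinorSum (A : Fin q → Matrix (Fin p) (Fin p) ℝ) (m : ℕ) :
    Sr A m = (1 / ((2 * m).factorial : ℝ)) *
      ∑ a : Fin m → Fin q, mixedMinorSum A fun k => a (halfIdx k) := by
  unfold Sr mixedMinorSum
  rw [Finset.sum_comm (s := (univ : Finset (Fin m → Fin q)))]
  congr 1
  refine Finset.sum_congr rfl fun i _ => ?_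
  simp_rw [Finset.mul_sum]
  rw [Finset.sum_comm]
  exact Finset.sum_congr rfl fun a _ => sum_gkron_mul_prod i fun k x => A (a (halfIdx k)) (i k) x

theorem statement_10 (hq : 1 ≤ q) (A : Fin q → Matrix (Fin p) (Fin p) ℝ) (m : ℕ) :
    Sr A m = ∑ u ∈ evenIdx q (2 * m),
      ((m.factorial : ℝ) / ∏ α, ((u α / 2).factorial : ℝ)) *
        ((∏ α, ((u α).factorial : ℝ)) / ((2 * m).factorial : ℝ)) * sigma A u := by
  have hmaps : ∀ a ∈ (univ : Finset (Fin m → Fin q)),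
      wt (fun k => a (halfIdx k)) ∈ evenIdx q (2 * m) := by
    intro a _
    have hsum := sum_wt fun k => a (halfIdx k)
    simp only [evenIdx, mem_filter, Fintype.mem_piFinset, mem_range, Nat.lt_succ_iff]
    refine ⟨fun α => ?_, fun α => ⟨wt a α, ?_⟩, hsum⟩
    · exact (Finset.single_le_sum (f := wt fun k => a (halfIdx k)) (fun _ _ => Nat.zero_le _)
        (mem_univ α)).trans_eq hsum
    · rw [wt_comp_halfIdx, two_mul]
  rw [Sr_eq_sum_mixedMinorSum, ← Finset.sum_fiberwise_of_maps_to hmaps, Finset.mul_sum]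
  refine Finset.sum_congr rfl fun u hu => ?_
  obtain ⟨-, heven, hsum⟩ := mem_filter.mp hu
  have hfilter : ({a | wt (fun k => a (halfIdx k)) = u} : Finset (Fin m → Fin q)) =
      ({a | wt a = fun α => u α / 2} : Finset (Fin m → Fin q)) := by
    refine Finset.filter_congr fun a _ => ?_
    simp only [funext_iff, wt_comp_halfIdx]
    refine forall_congr' fun α => ?_
    obtain ⟨v, hv⟩ := heven α
    lia
  have hhalf : ∑ α, u α / 2 = m := by
    have : 2 * ∑ α, u α / 2 = 2 * m := by
      rw [← hsum, Finset.mul_sum]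
      exact Finset.sum_congr rfl fun α _ => Nat.mul_div_cancel' (heven α).two_dvd
    lia
  have hconst : ∀ a ∈ ({a | wt (fun k => a (halfIdx k)) = u} : Finset (Fin m → Fin q)),
      (mixedMinorSum A fun k => a (halfIdx k)) = (∏ α, ((u α).factorial : ℝ)) * sigma A u := by
    intro a ha
    rw [mixedMinorSum_eq, (mem_filter.mp ha).2]
  rw [Finset.sum_congr rfl hconst, Finset.sum_const, nsmul_eq_mul, hfilter,
    ← card_wt_eq_mul_prod_factorial hhalf]
  have hne : ∏ α, ((u α / 2).factorial : ℝ) ≠ 0 :=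
    Finset.prod_ne_zero_iff.mpr fun α _ => Nat.cast_ne_zero.mpr (Nat.factorial_ne_zero _)
  push_cast
  rw [mul_div_cancel_right₀ _ hne]
  ring

end GNTPaper
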